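/- arXiv:2411.18569 — 9 statements merged into one kernel-verified Lean document; each statement's English description precedes it below -/
import Mathlib

section
/- (Winner must be active.) Let X ∈ ℝ^m and let î = argmax_{j∈[m]} X_j. If X ∈ A_α(θ) for some θ ∈ ℝ^m, then î ∈ I_α(θ), i.e. Δ_î(θ) ≤ 2 r_α(θ). -/
open Set

noncomputable section

/-- Suboptimality gap `Δ_j(θ) = max_i θ_i − θ_j`. -/
def gapv {m : ℕ} (θ : Fin m → ℝ) (j : Fin m) : ℝ := (⨆ i, θ i) - θ j

/-- Active radius `r_α(θ) = min {r ≥ 0 : 𝐒((max{r, Δ_j(θ)/2})_j) ≤ α}`. -/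
def rA {m : ℕ} (S : (Fin m → ℝ) → ℝ) (α : ℝ) (θ : Fin m → ℝ) : ℝ :=
  sInf {r : ℝ | 0 ≤ r ∧ S (fun j => max r (gapv θ j / 2)) ≤ α}

/-- Acceptance-region membership: `x ∈ A_α(θ)`. -/
def accept {m : ℕ} (S : (Fin m → ℝ) → ℝ) (α : ℝ) (θ x : Fin m → ℝ) : Prop :=
  ∀ j, |x j - θ j| ≤ max (rA S α θ) (gapv θ j / 2)

/-- **Winner must be active.** If `X ∈ A_α(θ)` and `î = argmax_j X_j`,
then `î ∈ I_α(θ)`, i.e. `Δ_î(θ) ≤ 2 r_α(θ)`. -/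
theorem winner_must_be_active
    (m : ℕ) (hm : 0 < m) (α : ℝ) (hα0 : 0 < α) (hα1 : α < 1)
    (S : (Fin m → ℝ) → ℝ)
    (hS0 : ∀ v : Fin m → ℝ, (∀ j, 0 ≤ v j) → 0 ≤ S v)
    (hScont : ContinuousOn S {v : Fin m → ℝ | ∀ j, 0 ≤ v j})
    (hSanti : ∀ v : Fin m → ℝ, (∀ j, 0 ≤ v j) → ∀ (j : Fin m) (a b : ℝ),
      0 ≤ a → a < b → S (Function.update v j b) < S (Function.update v j a))
    (hSlim : ∀ ε : ℝ, 0 < ε → ∃ M : ℝ, ∀ v : Fin m → ℝ, (∀ j, M ≤ v j) → S v < ε)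
    (X θ : Fin m → ℝ) (ih : Fin m) (hih : ∀ j, X j ≤ X ih)
    (hacc : accept S α θ X) :
    gapv θ ih ≤ 2 * rA S α θ := by
  by_contra hlt
  push Not at hlt
  have hr : 0 ≤ rA S α θ := Real.sInf_nonneg (fun r hr => hr.1)
  haveI : Nonempty (Fin m) := ⟨ih⟩
  obtain ⟨k, hk⟩ := exists_eq_ciSup_of_finite (f := θ)
  have hgk : gapv θ k = 0 := by simp [gapv, hk]
  have h1 := hacc k
  rw [hgk, zero_div, max_eq_left hr] at h1
  have h2 := hacc ih
  rw [max_eq_right (by linarith)] at h2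
  have h3 := (abs_le.mp h1).1
  have h4 := (abs_le.mp h2).2
  have h5 := hih k
  have h6 : gapv θ ih = θ k - θ ih := by simp [gapv, hk]
  linarith
end
end

section
/- (Only inactive gaps matter, part i.) Fix θ ∈ ℝ^m and let θ' ∈ ℝ^m be any vector such that Δ_j(θ') = Δ_j(θ) for all j in the inactive set I_α(θ)^c = [m] \ I_α(θ), and Δ_j(θ') ≤ Δ_j(θ) for all j ∈ I_α(θ). Then r_α(θ') = r_α(θ). -/
open Set

noncomputable section

theorem aux_anti {m : ℕ} (S : (Fin m → ℝ) → ℝ)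
    (hSanti : ∀ v : Fin m → ℝ, (∀ j, 0 ≤ v j) → ∀ (j : Fin m) (a b : ℝ),
      0 ≤ a → a < b → S (Function.update v j b) < S (Function.update v j a))
    (u v : Fin m → ℝ) (hu : ∀ j, 0 ≤ u j) (huv : ∀ j, u j ≤ v j) : S v ≤ S u := by
  have key : ∀ s : Finset (Fin m), S (s.piecewise v u) ≤ S u := by
    intro s
    induction s using Finset.induction_on with
    | empty => simp
    | insert a s ha ih =>
      refine le_trans ?_ ih
      rw [Finset.piecewise_insert]
      have h0 : ∀ j, 0 ≤ s.piecewise v u j := by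
        intro j
        by_cases h : j ∈ s
        · simpa [h] using (hu j).trans (huv j)
        · simpa [h] using hu j
      have h1 : Function.update (s.piecewise v u) a (u a) = s.piecewise v u := by
        rw [Function.update_eq_self_iff]
        simp [ha]
      rcases (huv a).eq_or_lt with h | h
      · rw [← h, h1]
      · have := hSanti _ h0 a (u a) (v a) (hu a) h
        rw [h1] at this
        exact this.le
  simpa using key Finset.univ

/-- **Only inactive gaps matter (i).** If `θ'` matches the gaps of `θ` on the
inactive set `I_α(θ)ᶜ = {j : Δ_j(θ) > 2 r_α(θ)}` and has no larger gaps on the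
active set `I_α(θ) = {j : Δ_j(θ) ≤ 2 r_α(θ)}`, then `r_α(θ') = r_α(θ)`. -/
theorem only_inactive_gaps_matter_i
    (m : ℕ) (hm : 0 < m) (α : ℝ) (hα0 : 0 < α) (hα1 : α < 1)
    (S : (Fin m → ℝ) → ℝ)
    (hS0 : ∀ v : Fin m → ℝ, (∀ j, 0 ≤ v j) → 0 ≤ S v)
    (hScont : ContinuousOn S {v : Fin m → ℝ | ∀ j, 0 ≤ v j})
    (hSanti : ∀ v : Fin m → ℝ, (∀ j, 0 ≤ v j) → ∀ (j : Fin m) (a b : ℝ),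
      0 ≤ a → a < b → S (Function.update v j b) < S (Function.update v j a))
    (hSlim : ∀ ε : ℝ, 0 < ε → ∃ M : ℝ, ∀ v : Fin m → ℝ, (∀ j, M ≤ v j) → S v < ε)
    (θ θ' : Fin m → ℝ)
    (hinact : ∀ j, ¬ gapv θ j ≤ 2 * rA S α θ → gapv θ' j = gapv θ j)
    (hact : ∀ j, gapv θ j ≤ 2 * rA S α θ → gapv θ' j ≤ gapv θ j) :
    rA S α θ' = rA S α θ := by
  have anti := aux_anti S hSanti
  have bdd : ∀ t : Fin m → ℝ,
      BddBelow {r : ℝ | 0 ≤ r ∧ S (fun j => max r (gapv t j / 2)) ≤ α} :=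
    fun t => ⟨0, fun r hr => hr.1⟩
  have hmem : rA S α θ ∈ {r : ℝ | 0 ≤ r ∧ S (fun j => max r (gapv θ j / 2)) ≤ α} := by
    have hc : ContinuousOn (fun r : ℝ => S (fun j => max r (gapv θ j / 2))) (Ici 0) := by
      refine hScont.comp (t := {v : Fin m → ℝ | ∀ j, 0 ≤ v j})
        (f := fun (r : ℝ) (j : Fin m) => max r (gapv θ j / 2)) ?_ ?_
      · exact (continuous_pi fun j => continuous_id.max continuous_const).continuousOn
      · intro r hr j
        exact le_max_of_le_left hr
    have hcl : IsClosed {r : ℝ | 0 ≤ r ∧ S (fun j => max r (gapv θ j / 2)) ≤ α} :=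
      hc.preimage_isClosed_of_isClosed isClosed_Ici isClosed_Iic
    refine hcl.csInf_mem ?_ (bdd θ)
    obtain ⟨M, hM⟩ := hSlim α hα0
    exact ⟨max M 0, le_max_right _ _,
      (hM _ fun j => (le_max_left M 0).trans (le_max_left _ _)).le⟩
  have hle : ∀ j, gapv θ' j ≤ gapv θ j := by
    intro j
    by_cases h : gapv θ j ≤ 2 * rA S α θ
    · exact hact j h
    · exact (hinact j h).le
  have hmem' : rA S α θ ∈ {r : ℝ | 0 ≤ r ∧ S (fun j => max r (gapv θ' j / 2)) ≤ α} := by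
    refine ⟨hmem.1, ?_⟩
    have : (fun j => max (rA S α θ) (gapv θ' j / 2))
        = fun j => max (rA S α θ) (gapv θ j / 2) := by
      funext j
      by_cases h : gapv θ j ≤ 2 * rA S α θ
      · have := hact j h
        rw [max_eq_left (by linarith), max_eq_left (by linarith)]
      · rw [hinact j h]
    rw [this]
    exact hmem.2
  apply le_antisymm
  · exact csInf_le (bdd θ') hmem'
  · refine le_csInf ⟨_, hmem'⟩ fun r hr => csInf_le (bdd θ) ⟨hr.1, le_trans ?_ hr.2⟩
    refine anti _ _ (fun j => le_max_of_le_left hr.1) fun j => max_le_max le_rfl ?_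
    linarith [hle j]
end
end

section
/- (Only inactive gaps matter, part ii.) Fix θ ∈ ℝ^m and let θ' ∈ ℝ^m be any vector such that Δ_j(θ') ≥ Δ_j(θ) for all j in the inactive set I_α(θ)^c = [m] \ I_α(θ). Then r_α(θ') ≤ r_α(θ). -/
open Set

noncomputable section

theorem anti_aux {m : ℕ} (S : (Fin m → ℝ) → ℝ)
    (hSanti : ∀ v : Fin m → ℝ, (∀ j, 0 ≤ v j) → ∀ (j : Fin m) (a b : ℝ),
      0 ≤ a → a < b → S (Function.update v j b) < S (Function.update v j a))
    (v w : Fin m → ℝ) (hv : ∀ j, 0 ≤ v j) (hvw : ∀ j, v j ≤ w j) : S w ≤ S v := by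
  have key : ∀ s : Finset (Fin m), S (s.piecewise w v) ≤ S v := by
    intro s
    induction s using Finset.induction_on with
    | empty => simp
    | insert j s hj ih =>
      rw [Finset.piecewise_insert]
      refine le_trans ?_ ih
      have hp : ∀ k, 0 ≤ s.piecewise w v k := by
        intro k
        by_cases hk : k ∈ s
        · simpa [hk] using (hv k).trans (hvw k)
        · simpa [hk] using hv k
      have he : s.piecewise w v = Function.update (s.piecewise w v) j (v j) := by
        rw [eq_comm, Function.update_eq_self_iff]
        simp [hj]
      rcases (hvw j).eq_or_lt with h | h
      · rw [← h, ← he]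
      · conv_rhs => rw [he]
        exact (hSanti _ hp j _ _ (hv j) h).le
  simpa using key Finset.univ

/-- **Only inactive gaps matter (ii).** If `θ'` has gaps at least as large as
those of `θ` on the inactive set `I_α(θ)ᶜ = {j : Δ_j(θ) > 2 r_α(θ)}`, then
`r_α(θ') ≤ r_α(θ)`. -/
theorem only_inactive_gaps_matter_ii
    (m : ℕ) (hm : 0 < m) (α : ℝ) (hα0 : 0 < α) (hα1 : α < 1)
    (S : (Fin m → ℝ) → ℝ)
    (hS0 : ∀ v : Fin m → ℝ, (∀ j, 0 ≤ v j) → 0 ≤ S v)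
    (hScont : ContinuousOn S {v : Fin m → ℝ | ∀ j, 0 ≤ v j})
    (hSanti : ∀ v : Fin m → ℝ, (∀ j, 0 ≤ v j) → ∀ (j : Fin m) (a b : ℝ),
      0 ≤ a → a < b → S (Function.update v j b) < S (Function.update v j a))
    (hSlim : ∀ ε : ℝ, 0 < ε → ∃ M : ℝ, ∀ v : Fin m → ℝ, (∀ j, M ≤ v j) → S v < ε)
    (θ θ' : Fin m → ℝ)
    (hinact : ∀ j, ¬ gapv θ j ≤ 2 * rA S α θ → gapv θ j ≤ gapv θ' j) :
    rA S α θ' ≤ rA S α θ := by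
  have hgap : ∀ (φ : Fin m → ℝ) j, 0 ≤ gapv φ j := fun φ j =>
    sub_nonneg.2 (le_ciSup (Set.finite_range φ).bddAbove j)
  have hbdd : ∀ φ : Fin m → ℝ,
      BddBelow {r : ℝ | 0 ≤ r ∧ S (fun j => max r (gapv φ j / 2)) ≤ α} :=
    fun φ => ⟨0, fun r hr => hr.1⟩
  have hne : {r : ℝ | 0 ≤ r ∧ S (fun j => max r (gapv θ j / 2)) ≤ α}.Nonempty := by
    obtain ⟨M, hM⟩ := hSlim α hα0
    exact ⟨max M 0, le_max_right _ _,
      (hM _ fun j => (le_max_left M 0).trans (le_max_left _ _)).le⟩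
  have hcl : IsClosed {r : ℝ | 0 ≤ r ∧ S (fun j => max r (gapv θ j / 2)) ≤ α} := by
    have hc : ContinuousOn (fun r : ℝ => S (fun j => max r (gapv θ j / 2))) (Set.Ici 0) := by
      refine hScont.comp (t := {v : Fin m → ℝ | ∀ j, 0 ≤ v j})
        (f := fun (r : ℝ) (j : Fin m) => max r (gapv θ j / 2)) ?_ ?_
      · exact Continuous.continuousOn (by fun_prop)
      · intro r hr j
        exact le_trans hr (le_max_left _ _)
    exact hc.preimage_isClosed_of_isClosed isClosed_Ici (isClosed_Iic (a := α))
  have hmem : 0 ≤ rA S α θ ∧ S (fun j => max (rA S α θ) (gapv θ j / 2)) ≤ α :=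
    hcl.csInf_mem hne (hbdd θ)
  refine csInf_le (hbdd θ') ⟨hmem.1, le_trans ?_ hmem.2⟩
  refine anti_aux S hSanti _ _ (fun j => le_trans hmem.1 (le_max_left _ _)) fun j => ?_
  by_cases h : gapv θ j ≤ 2 * rA S α θ
  · exact max_le (le_max_left _ _) (le_trans (by linarith) (le_max_left _ _))
  · have := hinact j h
    exact max_le_max le_rfl (by linarith)
end
end

section
/- (Increasing inactive coordinates cannot increase all their radii.) Fix θ ∈ ℝ^m and a nonempty index set I ⊆ I_α(θ)^c. Let θ' ∈ ℝ^m be any vector such that Δ_j(θ) ≤ Δ_j(θ') for all j ∈ I_α(θ)^c \ I and Δ_j(θ') < Δ_j(θ) for all j ∈ I. Let i₀ = argmax_{j∈I} Δ_j(θ). Then Δ_{i₀}(θ)/2 ≥ max{ r_α(θ'), Δ_{i₀}(θ')/2 }. -/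
open Set

noncomputable section

/-- **Increasing inactive coordinates cannot increase all their radii.**
Given a nonempty `I ⊆ I_α(θ)ᶜ`, and `θ'` whose gaps are at least those of `θ`
on `I_α(θ)ᶜ \ I` and strictly smaller on `I`, for `i₀ = argmax_{j∈I} Δ_j(θ)`
we have `Δ_{i₀}(θ)/2 ≥ max{r_α(θ'), Δ_{i₀}(θ')/2}`. -/
theorem increasing_inactive_coordinates
    (m : ℕ) (hm : 0 < m) (α : ℝ) (hα0 : 0 < α) (hα1 : α < 1)
    (S : (Fin m → ℝ) → ℝ)
    (hS0 : ∀ v : Fin m → ℝ, (∀ j, 0 ≤ v j) → 0 ≤ S v)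
    (hScont : ContinuousOn S {v : Fin m → ℝ | ∀ j, 0 ≤ v j})
    (hSanti : ∀ v : Fin m → ℝ, (∀ j, 0 ≤ v j) → ∀ (j : Fin m) (a b : ℝ),
      0 ≤ a → a < b → S (Function.update v j b) < S (Function.update v j a))
    (hSlim : ∀ ε : ℝ, 0 < ε → ∃ M : ℝ, ∀ v : Fin m → ℝ, (∀ j, M ≤ v j) → S v < ε)
    (θ θ' : Fin m → ℝ) (I : Set (Fin m)) (hIne : I.Nonempty)
    (hIsub : ∀ j ∈ I, ¬ gapv θ j ≤ 2 * rA S α θ)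
    (hgrow : ∀ j, ¬ gapv θ j ≤ 2 * rA S α θ → j ∉ I → gapv θ j ≤ gapv θ' j)
    (hshrink : ∀ j ∈ I, gapv θ' j < gapv θ j)
    (i0 : Fin m) (hi0 : i0 ∈ I) (hi0max : ∀ j ∈ I, gapv θ j ≤ gapv θ i0) :
    max (rA S α θ') (gapv θ' i0 / 2) ≤ gapv θ i0 / 2 := by
  refine max_le ?_ (by linarith [hshrink i0 hi0])
  have hne : {r : ℝ | 0 ≤ r ∧ S (fun j => max r (gapv θ j / 2)) ≤ α}.Nonempty := by
    obtain ⟨M, hM⟩ := hSlim α hα0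
    exact ⟨max M 0, le_max_right _ _,
      (hM _ fun j => (le_max_left M 0).trans (le_max_left _ _)).le⟩
  have hlt : rA S α θ < gapv θ i0 / 2 := by
    have := not_le.1 (hIsub i0 hi0)
    linarith
  obtain ⟨r, hr, hrR⟩ := exists_lt_of_csInf_lt hne hlt
  have hr1 : rA S α θ ≤ r := csInf_le ⟨0, fun x hx => hx.1⟩ hr
  have hr0 : 0 ≤ r := hr.1
  refine csInf_le ⟨0, fun x hx => hx.1⟩ ⟨by linarith, ?_⟩
  refine le_trans (anti_aux S hSanti (fun j => max r (gapv θ j / 2)) _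
    (fun j => hr0.trans (le_max_left _ _)) ?_) hr.2
  intro j
  refine max_le (hrR.le.trans (le_max_left _ _)) ?_
  by_cases hj : j ∈ I
  · exact le_max_of_le_left (by linarith [hi0max j hj])
  · by_cases ha : gapv θ j ≤ 2 * rA S α θ
    · exact le_max_of_le_left (by linarith)
    · exact le_max_of_le_right (by linarith [hgrow j ha hj])
end
end

section
/- (Zoom correction coverage.) Suppose X = θ + ξ where θ ∈ ℝ^m and ξ is a random vector with P(∃ j ∈ [m] : |ξ_j| > v_j) ≤ 𝐒(v) for every v ∈ [0,∞)^m, and suppose X almost surely has a unique maximizer î = argmax_{j∈[m]} X_j. Define Ĉ^α_î = { t ∈ ℝ : |X_î − t| ≤ r_α(θ^t) }, where θ^t is the worst-case vector with θ^t_î = t and θ^t_j = min{(2/3)X_j + (1/3)t, t} for j ≠ î, and set t_l = min Ĉ^α_î and t_u = max Ĉ^α_î (these are attained). Then P( θ_î ∈ [t_l, t_u] ) ≥ 1 − α. -/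
open MeasureTheory Set

noncomputable section

/-- The worst-case vector `θ^t`: `θ^t_î = t`, `θ^t_j = min{(2/3)X_j + (1/3)t, t}`
for `j ≠ î`. -/
def thetaT {m : ℕ} (X : Fin m → ℝ) (ih : Fin m) (t : ℝ) : Fin m → ℝ :=
  fun j => if j = ih then t else min (2 / 3 * X j + 1 / 3 * t) t

/-- The zoom-correction confidence set `Ĉ^α_î = {t : |X_î − t| ≤ r_α(θ^t)}`. -/
def Chat {m : ℕ} (S : (Fin m → ℝ) → ℝ) (α : ℝ) (X : Fin m → ℝ) (ih : Fin m) : Set ℝ :=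
  {t : ℝ | |X ih - t| ≤ rA S α (thetaT X ih t)}

lemma S_anti {m : ℕ} {S : (Fin m → ℝ) → ℝ}
    (hSanti : ∀ v : Fin m → ℝ, (∀ j, 0 ≤ v j) → ∀ (j : Fin m) (a b : ℝ),
      0 ≤ a → a < b → S (Function.update v j b) < S (Function.update v j a))
    (v w : Fin m → ℝ) (hv : ∀ j, 0 ≤ v j) (hvw : ∀ j, v j ≤ w j) : S w ≤ S v := by
  classical
  have key : ∀ s : Finset (Fin m), S (fun j => if j ∈ s then w j else v j) ≤ S v := by
    intro s
    induction s using Finset.induction_on with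
    | empty => simp
    | insert a s ha ih =>
      refine le_trans ?_ ih
      have e1 : (fun j => if j ∈ insert a s then w j else v j)
          = Function.update (fun j => if j ∈ s then w j else v j) a (w a) := by
        funext j
        by_cases h : j = a
        · subst h; simp
        · simp [Function.update, h]
      have e2 : (fun j => if j ∈ s then w j else v j)
          = Function.update (fun j => if j ∈ s then w j else v j) a (v a) := by
        funext j
        by_cases h : j = a
        · subst h; simp [ha]
        · simp [Function.update, h]
      rcases (hvw a).eq_or_lt with h | h
      · rw [e1, ← h, ← e2]
      · rw [e1]
        conv_rhs => rw [e2]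
        refine (hSanti _ ?_ a _ _ (hv a) h).le
        intro j
        split_ifs
        · exact (hv j).trans (hvw j)
        · exact hv j
  simpa using key Finset.univ

lemma S_strict {m : ℕ} {S : (Fin m → ℝ) → ℝ}
    (hSanti : ∀ v : Fin m → ℝ, (∀ j, 0 ≤ v j) → ∀ (j : Fin m) (a b : ℝ),
      0 ≤ a → a < b → S (Function.update v j b) < S (Function.update v j a))
    (v w : Fin m → ℝ) (hv : ∀ j, 0 ≤ v j) (hvw : ∀ j, v j ≤ w j) (i : Fin m)
    (hi : v i < w i) : S w < S v := by
  have h1 := hSanti v hv i (v i) (w i) (hv i) hi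
  rw [Function.update_eq_self] at h1
  refine lt_of_le_of_lt (S_anti hSanti _ _ ?_ ?_) h1
  · intro j
    by_cases h : j = i
    · subst h; simpa using (hv j).trans (hvw j)
    · simpa [Function.update, h] using hv j
  · intro j
    by_cases h : j = i
    · subst h; simp
    · simpa [Function.update, h] using hvw j

lemma gapv_nonneg {m : ℕ} (θ : Fin m → ℝ) (j : Fin m) : 0 ≤ gapv θ j := by
  unfold gapv
  have := le_ciSup (Set.finite_range θ).bddAbove j
  linarith

lemma gapv_thetaT {m : ℕ} (X : Fin m → ℝ) (i : Fin m) (t : ℝ) (j : Fin m) :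
    gapv (thetaT X i t) j = t - thetaT X i t j := by
  haveI : Nonempty (Fin m) := ⟨i⟩
  unfold gapv
  congr 1
  apply le_antisymm
  · apply ciSup_le
    intro k
    unfold thetaT
    split_ifs
    · exact le_rfl
    · exact min_le_right _ _
  · have := le_ciSup (Set.finite_range (thetaT X i t)).bddAbove i
    have e : thetaT X i t i = t := by simp [thetaT]
    rw [e] at this
    exact this

lemma rA_bdd {m : ℕ} (S : (Fin m → ℝ) → ℝ) (α : ℝ) (θ : Fin m → ℝ) :
    BddBelow {r : ℝ | 0 ≤ r ∧ S (fun j => max r (gapv θ j / 2)) ≤ α} := ⟨0, fun _ h => h.1⟩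

lemma rA_nonneg {m : ℕ} (S : (Fin m → ℝ) → ℝ) (α : ℝ) (θ : Fin m → ℝ) : 0 ≤ rA S α θ :=
  Real.sInf_nonneg fun _ h => h.1

lemma rA_cont {m : ℕ} {S : (Fin m → ℝ) → ℝ} 
    (hScont : ContinuousOn S {v : Fin m → ℝ | ∀ j, 0 ≤ v j}) (θ : Fin m → ℝ) :
    Continuous (fun r : ℝ => S (fun j => max r (gapv θ j / 2))) := by
  refine hScont.comp_continuous (by fun_prop) ?_
  intro r j
  have := gapv_nonneg θ j
  exact le_max_of_le_right (by linarith)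

lemma rA_mem {m : ℕ} {S : (Fin m → ℝ) → ℝ} {α : ℝ}
    (hScont : ContinuousOn S {v : Fin m → ℝ | ∀ j, 0 ≤ v j}) (θ : Fin m → ℝ)
    (hne : {r : ℝ | 0 ≤ r ∧ S (fun j => max r (gapv θ j / 2)) ≤ α}.Nonempty) :
    S (fun j => max (rA S α θ) (gapv θ j / 2)) ≤ α := by
  have hc : IsClosed {r : ℝ | 0 ≤ r ∧ S (fun j => max r (gapv θ j / 2)) ≤ α} :=
    (isClosed_le continuous_const continuous_id).inter
      (isClosed_le (rA_cont hScont θ) continuous_const)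
  exact (hc.csInf_mem hne (rA_bdd S α θ)).2

lemma rA_ge {m : ℕ} {S : (Fin m → ℝ) → ℝ} {α : ℝ}
    (hScont : ContinuousOn S {v : Fin m → ℝ | ∀ j, 0 ≤ v j}) (θ : Fin m → ℝ)
    (hpos : 0 < rA S α θ) :
    α ≤ S (fun j => max (rA S α θ) (gapv θ j / 2)) := by
  by_contra! h
  have ho : IsOpen {r : ℝ | 0 < r ∧ S (fun j => max r (gapv θ j / 2)) < α} :=
    (isOpen_lt continuous_const continuous_id).inter
      (isOpen_lt (rA_cont hScont θ) continuous_const)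
  obtain ⟨ε, hε, hb⟩ := Metric.isOpen_iff.1 ho _ ⟨hpos, h⟩
  have h2 : rA S α θ - ε / 2 ∈ Metric.ball (rA S α θ) ε := by
    rw [Metric.mem_ball, Real.dist_eq, abs_lt]; constructor <;> linarith
  have h3 := hb h2
  have h4 : rA S α θ ≤ rA S α θ - ε / 2 := csInf_le (rA_bdd S α θ) ⟨h3.1.le, h3.2.le⟩
  linarith

/-- **Zoom correction coverage.** If `X = θ + ξ` with tail bound `𝐒` and a.s.
unique empirical winner `î`, then `P(θ_î ∈ [t_l, t_u]) ≥ 1 − α`, where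
`t_l = min Ĉ^α_î` and `t_u = max Ĉ^α_î`. -/
theorem zoom_correction_coverage
    (m : ℕ) (hm : 0 < m) (α : ℝ) (hα0 : 0 < α) (hα1 : α < 1)
    (S : (Fin m → ℝ) → ℝ)
    (hS0 : ∀ v : Fin m → ℝ, (∀ j, 0 ≤ v j) → 0 ≤ S v)
    (hScont : ContinuousOn S {v : Fin m → ℝ | ∀ j, 0 ≤ v j})
    (hSanti : ∀ v : Fin m → ℝ, (∀ j, 0 ≤ v j) → ∀ (j : Fin m) (a b : ℝ),
      0 ≤ a → a < b → S (Function.update v j b) < S (Function.update v j a))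
    (hSlim : ∀ ε : ℝ, 0 < ε → ∃ M : ℝ, ∀ v : Fin m → ℝ, (∀ j, M ≤ v j) → S v < ε)
    (Ω : Type*) [MeasurableSpace Ω] (P : Measure Ω) [IsProbabilityMeasure P]
    (ξ : Ω → Fin m → ℝ)
    (htail : ∀ v : Fin m → ℝ, (∀ j, 0 ≤ v j) →
      P {ω | ∃ j, v j < |ξ ω j|} ≤ ENNReal.ofReal (S v))
    (θ : Fin m → ℝ)
    (ih : Ω → Fin m)
    (hih : ∀ᵐ ω ∂P, ∀ j, j ≠ ih ω → θ j + ξ ω j < θ (ih ω) + ξ ω (ih ω)) :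
    ENNReal.ofReal (1 - α) ≤
      P {ω | θ (ih ω) ∈
        Set.Icc (sInf (Chat S α (fun j => θ j + ξ ω j) (ih ω)))
                (sSup (Chat S α (fun j => θ j + ξ ω j) (ih ω)))} := by
  haveI : Nonempty (Fin m) := ⟨⟨0, hm⟩⟩
  obtain ⟨M, hM⟩ := hSlim α hα0
  have hmemM : ∀ η : Fin m → ℝ,
      max M 0 ∈ {r : ℝ | 0 ≤ r ∧ S (fun j => max r (gapv η j / 2)) ≤ α} := fun η =>
    ⟨le_max_right _ _, (hM _ fun j => (le_max_left M 0).trans (le_max_left _ _)).le⟩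
  set r := rA S α θ with hr
  have hr0 : 0 ≤ r := rA_nonneg S α θ
  set v : Fin m → ℝ := fun j => max r (gapv θ j / 2) with hv
  have hv0 : ∀ j, 0 ≤ v j := fun j => le_max_of_le_left hr0
  have hvα : S v ≤ α := rA_mem hScont θ ⟨_, hmemM θ⟩
  set A := {ω | θ (ih ω) ∈
        Set.Icc (sInf (Chat S α (fun j => θ j + ξ ω j) (ih ω)))
                (sSup (Chat S α (fun j => θ j + ξ ω j) (ih ω)))} with hA
  have hsub : P Aᶜ ≤ P {ω | ∃ j, v j < |ξ ω j|} := by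
    apply measure_mono_ae
    filter_upwards [hih] with ω hω
    intro hnA
    by_contra hbad
    have hbad : ∀ j, |ξ ω j| ≤ v j := by
      intro j
      by_contra! h
      exact hbad ⟨j, h⟩
    apply hnA
    set X : Fin m → ℝ := fun j => θ j + ξ ω j with hX
    set i := ih ω with hi
    have hxi : |ξ ω i| ≤ r := by
      obtain ⟨k, hk⟩ := exists_eq_ciSup_of_finite (f := θ)
      have hgk : gapv θ k = 0 := by unfold gapv; rw [hk]; ring
      have h1 : |ξ ω k| ≤ r := by
        have := hbad k
        simp only [hv, hgk] at this
        simpa [hr0] using this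
      have h2 : θ k + ξ ω k ≤ θ i + ξ ω i := by
        by_cases h : k = i
        · rw [h]
        · exact (hω k h).le
      have h3 : gapv θ i = θ k - θ i := by unfold gapv; rw [hk]
      have h4 := hbad i
      have h5 := abs_le.1 h1
      have h6 := abs_le.1 h4
      simp only [hv] at h4 h6
      rcases le_total (gapv θ i / 2) r with h | h
      · rwa [max_eq_left h] at h4
      · rw [max_eq_right h] at h4 h6
        linarith [h5.1, h6.2]
    have hmem : θ i ∈ Chat S α X i := by
      show |X i - θ i| ≤ rA S α (thetaT X i (θ i))
      have e : X i - θ i = ξ ω i := by simp [hX]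
      rw [e]
      refine hxi.trans ?_
      refine le_csInf ⟨_, hmemM _⟩ ?_
      rintro r' ⟨hr'0, hr'⟩
      by_contra! hlt
      have hge : α ≤ S v := rA_ge hScont θ (lt_of_le_of_lt hr'0 hlt)
      have hgi : gapv (thetaT X i (θ i)) i = 0 := by
        rw [gapv_thetaT]; simp [thetaT]
      have hri : r ≤ v i := le_max_left _ _
      have : S v < S (fun j => max r' (gapv (thetaT X i (θ i)) j / 2)) := by
        refine S_strict hSanti _ _ (fun j => le_max_of_le_left hr'0) ?_ i ?_
        · intro j
          refine max_le (hlt.le.trans (le_max_left _ _)) ?_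
          rw [gapv_thetaT]
          have hvr : r ≤ v j := le_max_left _ _
          have hvg : gapv θ j / 2 ≤ v j := le_max_right _ _
          have hg : θ i - θ j ≤ gapv θ j := by
            unfold gapv
            have := le_ciSup (Set.finite_range θ).bddAbove i
            linarith
          have h6 := (abs_le.1 (hbad j)).1
          unfold thetaT
          split_ifs
          · have := hv0 j
            linarith
          · rcases min_choice (2 / 3 * X j + 1 / 3 * θ i) (θ i) with h | h <;> rw [h]
            · simp only [hX]
              linarith
            · have := hv0 j
              linarith
        · simp only [hgi]
          rw [zero_div, max_eq_left hr'0]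
          exact hlt.trans_le hri
      linarith
    have hb : ∀ t ∈ Chat S α X i, |X i - t| ≤ max M 0 := fun t ht =>
      le_trans ht (csInf_le (rA_bdd S α _) (hmemM _))
    refine ⟨csInf_le ⟨X i - max M 0, fun t ht => ?_⟩ hmem,
      le_csSup ⟨X i + max M 0, fun t ht => ?_⟩ hmem⟩
    · linarith [(abs_le.1 (hb t ht)).2]
    · linarith [(abs_le.1 (hb t ht)).1]
  have hAc : P Aᶜ ≤ ENNReal.ofReal α :=
    hsub.trans ((htail v hv0).trans (ENNReal.ofReal_le_ofReal hvα))
  rw [ENNReal.ofReal_sub _ hα0.le, ENNReal.ofReal_one, tsub_le_iff_right]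
  calc (1 : ENNReal) = P Set.univ := measure_univ.symm
    _ = P (A ∪ Aᶜ) := by rw [Set.union_compl_self]
    _ ≤ P A + P Aᶜ := measure_union_le _ _
    _ ≤ P A + ENNReal.ofReal α := by gcongr
end
end

section
/- (Top-k winners must be active.) Fix k with 1 ≤ k ≤ m. Let X ∈ ℝ^m have pairwise distinct coordinates and let î_(1), …, î_(k) be the indices of its k largest coordinates. If X ∈ A_α(θ) for some θ ∈ ℝ^m (with A_α defined using the top-k gaps Δ^{(k)}), then î_(1), …, î_(k) ∈ I_α(θ), i.e. Δ^{(k)}_{î_(j)}(θ) ≤ 2 r_α(θ) for all j ∈ [k]. -/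
open Set

noncomputable section

/-- The `k`-th largest coordinate of `θ`. -/
def kth (m k : ℕ) (θ : Fin m → ℝ) : ℝ :=
  sSup {t : ℝ | k ≤ Set.ncard {j : Fin m | t ≤ θ j}}

/-- Top-`k` suboptimality gap `Δ^{(k)}_j(θ) = max{θ_(k) − θ_j, 0}`. -/
def gapk (m k : ℕ) (θ : Fin m → ℝ) (j : Fin m) : ℝ := max (kth m k θ - θ j) 0

/-- Top-`k` active radius `r_α(θ) = min {r ≥ 0 : 𝐒((max{r, Δ^{(k)}_j(θ)/2})_j) ≤ α}`. -/
def rAk (m k : ℕ) (S : (Fin m → ℝ) → ℝ) (α : ℝ) (θ : Fin m → ℝ) : ℝ :=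
  sInf {r : ℝ | 0 ≤ r ∧ S (fun j => max r (gapk m k θ j / 2)) ≤ α}

/-- Top-`k` acceptance-region membership: `x ∈ A_α(θ)`. -/
def acceptk (m k : ℕ) (S : (Fin m → ℝ) → ℝ) (α : ℝ) (θ x : Fin m → ℝ) : Prop :=
  ∀ j, |x j - θ j| ≤ max (rAk m k S α θ) (gapk m k θ j / 2)

/-- **Top-k winners must be active.** If `X ∈ A_α(θ)` and `î_(1), …, î_(k)` are
the indices of the `k` largest coordinates of `X`, then
`Δ^{(k)}_{î_(a)}(θ) ≤ 2 r_α(θ)` for every `a`. -/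
theorem topk_winners_active
    (m k : ℕ) (hm : 0 < m) (hk : 0 < k) (hkm : k ≤ m)
    (α : ℝ) (hα0 : 0 < α) (hα1 : α < 1)
    (S : (Fin m → ℝ) → ℝ)
    (hS0 : ∀ v : Fin m → ℝ, (∀ j, 0 ≤ v j) → 0 ≤ S v)
    (hScont : ContinuousOn S {v : Fin m → ℝ | ∀ j, 0 ≤ v j})
    (hSanti : ∀ v : Fin m → ℝ, (∀ j, 0 ≤ v j) → ∀ (j : Fin m) (a b : ℝ),
      0 ≤ a → a < b → S (Function.update v j b) < S (Function.update v j a))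
    (hSlim : ∀ ε : ℝ, 0 < ε → ∃ M : ℝ, ∀ v : Fin m → ℝ, (∀ j, M ≤ v j) → S v < ε)
    (X : Fin m → ℝ) (hXinj : Function.Injective X)
    (ihat : Fin k → Fin m) (hinj : Function.Injective ihat)
    (hdec : ∀ a b : Fin k, a < b → X (ihat b) < X (ihat a))
    (hout : ∀ j, j ∉ Set.range ihat → ∀ a, X j < X (ihat a))
    (θ : Fin m → ℝ) (hacc : acceptk m k S α θ X) :
    ∀ a : Fin k, gapk m k θ (ihat a) ≤ 2 * rAk m k S α θ := by
  intro a
  by_contra! hlt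
  have hr : 0 ≤ rAk m k S α θ := Real.sInf_nonneg (fun r hr => hr.1)
  have hi := hacc (ihat a)
  rw [max_eq_right (by linarith)] at hi
  have hg : gapk m k θ (ihat a) = kth m k θ - θ (ihat a) := by
    unfold gapk at hlt ⊢
    rcases le_total (kth m k θ - θ (ihat a)) 0 with h | h
    · rw [max_eq_right h] at hlt; linarith
    · exact max_eq_left h
  rw [hg] at hi hlt
  have hi2 := (abs_le.1 hi).2
  set κ := kth m k θ with hκ
  set r := rAk m k S α θ with hrdef
  obtain ⟨ε, hε⟩ : ∃ ε : ℝ, ε = ((κ - θ (ihat a)) / 2 - r) / 2 := ⟨_, rfl⟩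
  have hε0 : 0 < ε := by linarith
  have hne : {t : ℝ | k ≤ Set.ncard {j : Fin m | t ≤ θ j}}.Nonempty := by
    obtain ⟨t, ht⟩ := (Set.finite_range θ).bddBelow
    refine ⟨t, ?_⟩
    have : {j : Fin m | t ≤ θ j} = Set.univ := by
      ext j; simp [ht (Set.mem_range_self j)]
    simp only [Set.mem_setOf_eq, this, Set.ncard_univ, Nat.card_eq_fintype_card, Fintype.card_fin]
    exact hkm
  obtain ⟨t, ht, htlt⟩ := exists_lt_of_lt_csSup hne (show κ - ε < sSup _ by
    change κ - ε < κ; linarith)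
  have hX : ∀ j, t ≤ θ j → X (ihat a) < X j := by
    intro j hj
    have h1 := (abs_le.1 (hacc j)).1
    have h2 : gapk m k θ j ≤ ε := max_le (by linarith) hε0.le
    have h3 : max r (gapk m k θ j / 2) ≤ r + ε / 2 := max_le (by linarith) (by linarith)
    linarith
  have hsub : {j : Fin m | t ≤ θ j} ⊆ Set.range ihat \ {ihat a} := by
    intro j hj
    have := hX j hj
    refine ⟨?_, ?_⟩
    · by_contra hn
      exact lt_asymm this (hout j hn a)
    · rintro rfl
      exact lt_irrefl _ this
  have hcard := Set.ncard_le_ncard hsub (Set.toFinite _)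
  rw [Set.ncard_diff_singleton_of_mem (Set.mem_range_self a)] at hcard
  have hrc : (Set.range ihat).ncard = k := by
    rw [← Set.image_univ, Set.ncard_image_of_injective _ hinj, Set.ncard_univ]; simp
  have ht' : k ≤ Set.ncard {j : Fin m | t ≤ θ j} := ht
  omega
end
end

section
/- (Zoom correction for the top k, coverage.) Fix k with 1 ≤ k ≤ m. Suppose X = θ + ξ where θ ∈ ℝ^m and ξ is a random vector with P(∃ j ∈ [m] : |ξ_j| > v_j) ≤ 𝐒(v) for every v ∈ [0,∞)^m, and suppose X almost surely has pairwise distinct coordinates, with top-k indices î_(1), …, î_(k). Let r_max = max{ r ∈ ℝ : r ≤ r_α(θ̃^r) }, where θ̃^r_j = X_j − r for j ∈ {î_(1),…,î_(k)} and θ̃^r_j = min{ (2/3)X_j + (1/3)(X_{î_(k)} − r), X_{î_(k)} − r } otherwise (this maximum is attained). Then P( |θ_{î_(j)} − X_{î_(j)}| ≤ r_max for every j ∈ [k] ) ≥ 1 − α. -/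
open MeasureTheory Set

noncomputable section

/-- The vector `θ̃^r`: `θ̃^r_j = X_j − r` on the top-`k` indices and
`θ̃^r_j = min{(2/3)X_j + (1/3)(X_{î_(k)} − r), X_{î_(k)} − r}` otherwise
(`xk` stands for `X_{î_(k)}`). -/
def thetaTil (m k : ℕ) (X : Fin m → ℝ) (ihat : Fin k → Fin m) (xk r : ℝ) :
    Fin m → ℝ :=
  fun j =>
    if ∃ a, ihat a = j then X j - r
    else min (2 / 3 * X j + 1 / 3 * (xk - r)) (xk - r)

/-- `r_max = max{r : r ≤ r_α(θ̃^r)}`. -/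
def rMax (m k : ℕ) (S : (Fin m → ℝ) → ℝ) (α : ℝ) (X : Fin m → ℝ)
    (ihat : Fin k → Fin m) (xk : ℝ) : ℝ :=
  sSup {r : ℝ | r ≤ rAk m k S α (thetaTil m k X ihat xk r)}

theorem aux_mono (m : ℕ) (S : (Fin m → ℝ) → ℝ)
    (hSanti : ∀ v : Fin m → ℝ, (∀ j, 0 ≤ v j) → ∀ (j : Fin m) (a b : ℝ),
      0 ≤ a → a < b → S (Function.update v j b) < S (Function.update v j a))
    (u v : Fin m → ℝ) (hu : ∀ j, 0 ≤ u j) (huv : ∀ j, u j ≤ v j) : S v ≤ S u := by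
  classical
  have key : ∀ A : Finset (Fin m), S (A.piecewise v u) ≤ S u := by
    intro A
    induction A using Finset.induction_on with
    | empty => simp
    | insert a A ha ih =>
      rw [Finset.piecewise_insert]
      refine le_trans ?_ ih
      have hx : Function.update (A.piecewise v u) a (u a) = A.piecewise v u := by
        have : u a = A.piecewise v u a := by simp [ha]
        rw [this]; exact Function.update_eq_self _ _
      have h0 : ∀ j, 0 ≤ A.piecewise v u j := by
        intro j
        by_cases hj : j ∈ A
        · simp only [hj, Finset.piecewise_eq_of_mem]; exact (hu j).trans (huv j)
        · simp only [hj, not_false_eq_true, Finset.piecewise_eq_of_notMem]; exact hu j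
      rcases (huv a).eq_or_lt with h | h
      · rw [← h, hx]
      · have := hSanti _ h0 a (u a) (v a) (hu a) h
        rw [hx] at this
        exact this.le
  simpa using key Finset.univ

theorem aux_bdd (m k : ℕ) (hk : 0 < k) (θ : Fin m → ℝ) :
    BddAbove {t : ℝ | k ≤ Set.ncard {j : Fin m | t ≤ θ j}} := by
  obtain ⟨M, hM⟩ := (Set.finite_range θ).bddAbove
  refine ⟨M, fun t ht => ?_⟩
  have : Set.ncard {j : Fin m | t ≤ θ j} ≠ 0 := by
    have : k ≤ _ := ht
    omega
  obtain ⟨j, hj⟩ := Set.nonempty_of_ncard_ne_zero this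
  exact le_trans hj (hM ⟨j, rfl⟩)

theorem aux_ne (m k : ℕ) (hk : 0 < k) (hkm : k ≤ m) (θ : Fin m → ℝ) :
    {t : ℝ | k ≤ Set.ncard {j : Fin m | t ≤ θ j}}.Nonempty := by
  obtain ⟨M, hM⟩ := (Set.finite_range θ).bddBelow
  refine ⟨M, ?_⟩
  have : {j : Fin m | M ≤ θ j} = Set.univ := by
    ext j; simp; exact hM ⟨j, rfl⟩
  simp [this, Set.ncard_univ, hkm]

theorem aux_kth_mem (m k : ℕ) (hk : 0 < k) (hkm : k ≤ m) (θ : Fin m → ℝ) :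
    k ≤ Set.ncard {j : Fin m | kth m k θ ≤ θ j} := by
  set c := kth m k θ with hc
  have h1 : ∀ᶠ s in nhdsWithin c (Set.Iio c), ∀ j, θ j < c → θ j < s := by
    rw [Filter.eventually_all]
    intro j
    by_cases h : θ j < c
    · filter_upwards [nhdsWithin_le_nhds (lt_mem_nhds h)] with s hs _ using hs
    · exact Filter.Eventually.of_forall fun s h' => absurd h' h
  obtain ⟨s, hs, hsc⟩ := (h1.and self_mem_nhdsWithin).exists
  obtain ⟨t, ht, hst⟩ := exists_lt_of_lt_csSup (aux_ne m k hk hkm θ) (show s < sSup _ from hsc)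
  refine le_trans (show k ≤ _ from ht) (Set.ncard_le_ncard ?_ (Set.toFinite _))
  intro j hj
  by_contra hcon
  have h2 := hs j (not_le.mp hcon)
  have h3 : t ≤ θ j := hj
  linarith

theorem aux_core (m k : ℕ) (hk : 0 < k) (hkm : k ≤ m)
    (α : ℝ) (S : (Fin m → ℝ) → ℝ)
    (hSanti : ∀ v : Fin m → ℝ, (∀ j, 0 ≤ v j) → ∀ (j : Fin m) (a b : ℝ),
      0 ≤ a → a < b → S (Function.update v j b) < S (Function.update v j a))
    (M : ℝ) (hM : ∀ v : Fin m → ℝ, (∀ j, M ≤ v j) → S v < α)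
    (θ X : Fin m → ℝ) (ihat : Fin k → Fin m) (xk : ℝ) (a0 : Fin k)
    (hxk : xk = X (ihat a0)) (hmin : ∀ a, xk ≤ X (ihat a))
    (hinj : Function.Injective ihat)
    (hout : ∀ j, j ∉ Set.range ihat → ∀ a, X j < X (ihat a))
    (hev : ∀ j, |X j - θ j| ≤ max (rAk m k S α θ) (gapk m k θ j / 2)) (a : Fin k) :
    |X (ihat a) - θ (ihat a)| ≤ rMax m k S α X ihat xk := by
  classical
  haveI : Nonempty (Fin k) := ⟨a0⟩
  set rs := rAk m k S α θ with hrs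
  have hmemM : ∀ η : Fin m → ℝ, max M 0 ∈ {r : ℝ | 0 ≤ r ∧ S (fun j => max r (gapk m k η j / 2)) ≤ α} := by
    intro η
    refine ⟨le_max_right _ _, (hM _ fun j => ?_).le⟩
    exact (le_max_left _ _).trans (le_max_left _ _)
  have hbb : ∀ η : Fin m → ℝ, BddBelow {r : ℝ | 0 ≤ r ∧ S (fun j => max r (gapk m k η j / 2)) ≤ α} :=
    fun η => ⟨0, fun r hr => hr.1⟩
  have hgap0 : ∀ η j, 0 ≤ gapk m k η j := fun η j => le_max_right _ _
  have hcardr : (Set.range ihat).ncard = k := by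
    rw [← Set.image_univ, Set.ncard_image_of_injective _ hinj, Set.ncard_univ]; simp
  -- step 1
  have hstep1 : ∀ a, |X (ihat a) - θ (ihat a)| ≤ rs := by
    intro a
    by_contra hcon
    push Not at hcon
    have h1 := hev (ihat a)
    have h2 : rs < gapk m k θ (ihat a) / 2 := by
      by_contra h; rw [max_eq_left (not_lt.mp h)] at h1; linarith
    rw [max_eq_right h2.le] at h1
    have hrs0 : 0 ≤ rs := by
      rw [hrs]; exact Real.sInf_nonneg fun r hr => hr.1
    have hgpos : gapk m k θ (ihat a) = kth m k θ - θ (ihat a) := by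
      unfold gapk at h2 ⊢
      rcases max_cases (kth m k θ - θ (ihat a)) 0 with h | h
      · exact h.1
      · rw [h.1] at h2; linarith
    -- there is a true top index not selected
    have hex : ∃ i, kth m k θ ≤ θ i ∧ i ∉ Set.range ihat := by
      by_contra hno
      push Not at hno
      have hsub : {j : Fin m | kth m k θ ≤ θ j} ⊆ Set.range ihat \ {ihat a} := by
        intro j hj
        refine ⟨hno j hj, ?_⟩
        rintro rfl
        have : kth m k θ ≤ θ (ihat a) := hj
        linarith
      have h3 := Set.ncard_le_ncard hsub (Set.toFinite _)
      have h4 := Set.ncard_diff_singleton_add_one (Set.mem_range_self a) (Set.toFinite (Set.range ihat))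
      have h5 := aux_kth_mem m k hk hkm θ
      omega
    obtain ⟨i, hi, hir⟩ := hex
    have h3 := hout i hir a
    have h4 := hev i
    have h5 : gapk m k θ i = 0 := max_eq_right (by linarith)
    rw [h5, zero_div, max_eq_left hrs0] at h4
    have := (abs_le.mp h4).1
    have := (abs_le.mp h1).2
    linarith
  obtain ⟨a1, ha1⟩ := Finite.exists_max (fun a => |X (ihat a) - θ (ihat a)|)
  set R := |X (ihat a1) - θ (ihat a1)| with hR
  have hRrs : R ≤ rs := hstep1 a1
  refine (ha1 a).trans ?_
  unfold rMax
  refine le_csSup ⟨max M 0, fun r hr => le_trans hr (csInf_le (hbb _) (hmemM _))⟩ ?_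
  show R ≤ rAk m k S α (thetaTil m k X ihat xk R)
  refine le_csInf ⟨_, hmemM _⟩ ?_
  rintro r ⟨hr0, hrS⟩
  by_contra hrR
  push Not at hrR
  set η := thetaTil m k X ihat xk R with hη
  have hkη : kth m k η ≤ xk - R := by
    refine csSup_le (aux_ne m k hk hkm η) ?_
    intro s hs
    by_contra hlt
    push Not at hlt
    have hsub : {j : Fin m | s ≤ η j} ⊆ Set.range ihat \ {ihat a0} := by
      intro j hj
      have hj' : s ≤ η j := hj
      constructor
      · by_contra hjr
        have : ¬ ∃ a, ihat a = j := hjr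
        simp only [hη, thetaTil, this, if_false] at hj'
        have := min_le_right (2 / 3 * X j + 1 / 3 * (xk - R)) (xk - R)
        linarith
      · rintro rfl
        have : ∃ a, ihat a = ihat a0 := ⟨a0, rfl⟩
        simp only [hη, thetaTil, this, if_true] at hj'
        linarith
    have h3 := Set.ncard_le_ncard hsub (Set.toFinite _)
    have h4 := Set.ncard_diff_singleton_add_one (Set.mem_range_self a0) (Set.toFinite (Set.range ihat))
    have h5 : k ≤ _ := hs
    omega
  have hkθ : xk - R ≤ kth m k θ := by
    refine le_csSup (aux_bdd m k hk θ) ?_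
    show k ≤ _
    rw [← hcardr]
    refine Set.ncard_le_ncard ?_ (Set.toFinite _)
    rintro _ ⟨b, rfl⟩
    show xk - R ≤ θ (ihat b)
    have h1 := (abs_le.mp (ha1 b)).2
    have h2 := hmin b
    linarith
  have hR0 : 0 ≤ R := abs_nonneg _
  have hu : ∀ j, max r (gapk m k η j / 2) < rs ∨ max r (gapk m k η j / 2) ≤ max r (gapk m k θ j / 2) := by
    intro j
    by_cases hj : ∃ a, ihat a = j
    · obtain ⟨b, rfl⟩ := hj
      left
      have : ∃ a, ihat a = ihat b := ⟨b, rfl⟩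
      have h1 : η (ihat b) = X (ihat b) - R := by simp only [hη, thetaTil, this, if_true]
      have h2 : gapk m k η (ihat b) = 0 := by
        refine max_eq_right ?_
        have := hmin b
        rw [h1]; linarith
      rw [h2, zero_div, max_eq_left hr0]; linarith
    · have h1 : η j = min (2 / 3 * X j + 1 / 3 * (xk - R)) (xk - R) := by
        simp only [hη, thetaTil, hj, if_false]
      have hgθ : kth m k θ - θ j ≤ gapk m k θ j := le_max_left _ _
      have h0 := hgap0 θ j
      have h4 := (abs_le.mp (hev j)).1
      have hg : gapk m k η j ≤ max (2 / 3 * (xk - R - X j)) 0 := by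
        unfold gapk
        rw [h1]
        refine max_le ?_ (le_max_right _ _)
        rcases min_cases (2 / 3 * X j + 1 / 3 * (xk - R)) (xk - R) with h | h
        · rw [h.1]; refine le_trans ?_ (le_max_left _ _); linarith
        · rw [h.1]; refine le_trans ?_ (le_max_right _ _); linarith
      by_cases hc : gapk m k θ j / 2 < rs
      · left
        rw [max_eq_left hc.le] at h4
        refine max_lt (by linarith) ?_
        have : max (2 / 3 * (xk - R - X j)) 0 < 2 * rs := max_lt (by linarith) (by linarith)
        linarith
      · right
        rw [max_eq_right (not_lt.mp hc)] at h4
        have : max (2 / 3 * (xk - R - X j)) 0 ≤ gapk m k θ j := max_le (by linarith) h0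
        exact max_le_max le_rfl (by linarith)
  -- choose r'
  haveI : Nonempty (Fin m) := ⟨ihat a0⟩
  obtain ⟨j1, hj1⟩ := Finite.exists_max
    (fun j => if max r (gapk m k η j / 2) < rs then max r (gapk m k η j / 2) else r)
  set r' := (if max r (gapk m k η j1 / 2) < rs then max r (gapk m k η j1 / 2) else r) with hr'
  have hr'lt : r' < rs := by
    rw [hr']; split_ifs with h
    · exact h
    · linarith
  have hrr' : r ≤ r' := by
    rw [hr']; split_ifs with h
    · exact le_max_left _ _
    · exact le_rfl
  have hle : ∀ j, max r (gapk m k η j / 2) ≤ max r' (gapk m k θ j / 2) := by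
    intro j
    by_cases h : max r (gapk m k η j / 2) < rs
    · have := hj1 j
      simp only [h, if_true] at this
      exact this.trans (le_max_left _ _)
    · rcases hu j with h' | h'
      · exact absurd h' h
      · exact h'.trans (max_le_max hrr' le_rfl)
  have hSle := aux_mono m S hSanti _ _ (fun j => hr0.trans (le_max_left r (gapk m k η j / 2))) hle
  have : rs ≤ r' := csInf_le (hbb θ) ⟨hr0.trans hrr', hSle.trans hrS⟩
  linarith

theorem aux_attained (m k : ℕ) (α : ℝ) (S : (Fin m → ℝ) → ℝ)
    (hScont : ContinuousOn S {v : Fin m → ℝ | ∀ j, 0 ≤ v j})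
    (M : ℝ) (hM : ∀ v : Fin m → ℝ, (∀ j, M ≤ v j) → S v < α) (θ : Fin m → ℝ) :
    0 ≤ rAk m k S α θ ∧ S (fun j => max (rAk m k S α θ) (gapk m k θ j / 2)) ≤ α := by
  have hc : IsClosed {r : ℝ | 0 ≤ r ∧ S (fun j => max r (gapk m k θ j / 2)) ≤ α} := by
    have h1 : ContinuousOn (fun r : ℝ => S (fun j => max r (gapk m k θ j / 2))) (Set.Ici 0) := by
      refine hScont.comp (by fun_prop) ?_
      intro r hr j
      exact le_trans hr (le_max_left _ _)
    exact h1.preimage_isClosed_of_isClosed isClosed_Ici (isClosed_Iic (a := α))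
  refine hc.csInf_mem ⟨max M 0, le_max_right _ _, (hM _ fun j => ?_).le⟩ ⟨0, fun r hr => hr.1⟩
  exact (le_max_left _ _).trans (le_max_left _ _)

/-- **Zoom correction for the top k: coverage.** If `X = θ + ξ` with tail bound
`𝐒`, and `X` almost surely has pairwise distinct coordinates with top-`k`
indices `î_(1), …, î_(k)`, then
`P(|θ_{î_(a)} − X_{î_(a)}| ≤ r_max for all a ∈ [k]) ≥ 1 − α`. -/
theorem topk_zoom_coverage
    (m k : ℕ) (hm : 0 < m) (hk : 0 < k) (hkm : k ≤ m)
    (α : ℝ) (hα0 : 0 < α) (hα1 : α < 1)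
    (S : (Fin m → ℝ) → ℝ)
    (hS0 : ∀ v : Fin m → ℝ, (∀ j, 0 ≤ v j) → 0 ≤ S v)
    (hScont : ContinuousOn S {v : Fin m → ℝ | ∀ j, 0 ≤ v j})
    (hSanti : ∀ v : Fin m → ℝ, (∀ j, 0 ≤ v j) → ∀ (j : Fin m) (a b : ℝ),
      0 ≤ a → a < b → S (Function.update v j b) < S (Function.update v j a))
    (hSlim : ∀ ε : ℝ, 0 < ε → ∃ M : ℝ, ∀ v : Fin m → ℝ, (∀ j, M ≤ v j) → S v < ε)
    (Ω : Type*) [MeasurableSpace Ω] (P : Measure Ω) [IsProbabilityMeasure P]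
    (ξ : Ω → Fin m → ℝ)
    (htail : ∀ v : Fin m → ℝ, (∀ j, 0 ≤ v j) →
      P {ω | ∃ j, v j < |ξ ω j|} ≤ ENNReal.ofReal (S v))
    (θ : Fin m → ℝ)
    (ihat : Ω → Fin k → Fin m)
    (hdist : ∀ᵐ ω ∂P, Function.Injective (fun j => θ j + ξ ω j))
    (htop : ∀ᵐ ω ∂P,
      Function.Injective (ihat ω) ∧
      (∀ a b : Fin k, a < b →
        θ (ihat ω b) + ξ ω (ihat ω b) < θ (ihat ω a) + ξ ω (ihat ω a)) ∧
      (∀ j, j ∉ Set.range (ihat ω) → ∀ a,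
        θ j + ξ ω j < θ (ihat ω a) + ξ ω (ihat ω a))) :
    ENNReal.ofReal (1 - α) ≤
      P {ω | ∀ a : Fin k,
        |θ (ihat ω a) - (θ (ihat ω a) + ξ ω (ihat ω a))| ≤
          rMax m k S α (fun j => θ j + ξ ω j) (ihat ω)
            (θ (ihat ω ⟨k - 1, Nat.sub_lt hk Nat.one_pos⟩) +
              ξ ω (ihat ω ⟨k - 1, Nat.sub_lt hk Nat.one_pos⟩))} := by
  obtain ⟨M, hM⟩ := hSlim α hα0
  obtain ⟨hr0, hrS⟩ := aux_attained m k α S hScont M hM θ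
  have hbad := htail _ (fun j => hr0.trans (le_max_left _ (gapk m k θ j / 2)))
  have hbad' := hbad.trans (ENNReal.ofReal_le_ofReal hrS)
  set B := {ω | ∃ j, max (rAk m k S α θ) (gapk m k θ j / 2) < |ξ ω j|} with hB
  set G := {ω | ∀ a : Fin k,
        |θ (ihat ω a) - (θ (ihat ω a) + ξ ω (ihat ω a))| ≤
          rMax m k S α (fun j => θ j + ξ ω j) (ihat ω)
            (θ (ihat ω ⟨k - 1, Nat.sub_lt hk Nat.one_pos⟩) +
              ξ ω (ihat ω ⟨k - 1, Nat.sub_lt hk Nat.one_pos⟩))} with hG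
  have hcov : ∀ᵐ ω ∂P, ω ∈ G ∪ B := by
    filter_upwards [htop] with ω hω
    by_cases hb : ω ∈ B
    · exact Or.inr hb
    · left
      intro a
      have hb' : ∀ j, |ξ ω j| ≤ max (rAk m k S α θ) (gapk m k θ j / 2) := by
        intro j
        by_contra h
        exact hb ⟨j, not_le.mp h⟩
      rw [abs_sub_comm]
      refine aux_core m k hk hkm α S hSanti M hM θ (fun j => θ j + ξ ω j) (ihat ω) _
        ⟨k - 1, Nat.sub_lt hk Nat.one_pos⟩ rfl ?_ hω.1 hω.2.2 ?_ a
      · intro b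
        rcases lt_or_eq_of_le (show b ≤ ⟨k - 1, Nat.sub_lt hk Nat.one_pos⟩ from
          Nat.le_sub_one_of_lt b.2) with h | h
        · exact (hω.2.1 _ _ h).le
        · rw [h]
      · intro j
        have : θ j + ξ ω j - θ j = ξ ω j := by ring
        simpa only [this] using hb' j
  have h1 : (1 : ENNReal) ≤ P G + ENNReal.ofReal α := by
    calc (1 : ENNReal) = P Set.univ := measure_univ.symm
      _ ≤ P (G ∪ B) := measure_mono_ae (by filter_upwards [hcov] with ω h _ using h)
      _ ≤ P G + P B := measure_union_le _ _
      _ ≤ _ := by gcongr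
  rw [ENNReal.ofReal_sub _ hα0.le, ENNReal.ofReal_one]
  exact tsub_le_iff_right.mpr h1
end
end

section
/- (Endpoint equation, top-k case.) Fix k with 1 ≤ k ≤ m, and suppose 𝐒(v) = Σ_{i=1}^m S(v_i) with S : [0,∞) → [0,1] continuous, strictly decreasing, S(0) = 1, S(r) → 0 as r → ∞. Let X ∈ ℝ^m have pairwise distinct coordinates with top-k indices î_(1), …, î_(k), and let Δ̂^{(k)}_j = X_{î_(k)} − X_j. Then r_max = max{ r : r ≤ r_α(θ̃^r) } solves the equation α = Σ_{j=1}^m S( max{ r, (Δ̂^{(k)}_j − r)/3 } ). -/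
open Set

noncomputable section

open Set Filter Topology in
theorem kth_thetaTil (m k : ℕ) (hk : 0 < k) (X : Fin m → ℝ)
    (ihat : Fin k → Fin m) (hinj : Function.Injective ihat)
    (hdec : ∀ a b : Fin k, a < b → X (ihat b) < X (ihat a)) (l : Fin k)
    (hl : ∀ a, a ≤ l) (r : ℝ) :
    kth m k (thetaTil m k X ihat (X (ihat l)) r) = X (ihat l) - r := by
  have hle : ∀ a, X (ihat l) ≤ X (ihat a) := by
    intro a
    rcases (hl a).lt_or_eq with h | h
    · exact (hdec _ _ h).le
    · rw [h]
  have hcard : (Set.range ihat).ncard = k := by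
    rw [← Set.image_univ, Set.ncard_image_of_injective _ hinj, Set.ncard_univ, Nat.card_fin]
  unfold kth
  apply IsGreatest.csSup_eq
  constructor
  · show k ≤ _
    conv_lhs => rw [← hcard]
    apply Set.ncard_le_ncard _ (Set.toFinite _)
    rintro _ ⟨a, rfl⟩
    have := hle a
    simp [thetaTil, this]
  · intro t ht
    by_contra! hlt
    have hsub : {j : Fin m | t ≤ thetaTil m k X ihat (X (ihat l)) r j}
        ⊂ Set.range ihat := by
      refine (Set.ssubset_iff_of_subset ?_).2 ⟨ihat l, ⟨l, rfl⟩, ?_⟩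
      · intro j hj
        by_contra hn
        have hn' : ¬ ∃ a, ihat a = j := hn
        simp only [thetaTil, Set.mem_setOf_eq, if_neg hn'] at hj
        have := min_le_right (2 / 3 * X j + 1 / 3 * (X (ihat l) - r)) (X (ihat l) - r)
        linarith
      · simp only [thetaTil, Set.mem_setOf_eq, if_pos (⟨l, rfl⟩ : ∃ a, ihat a = ihat l)]
        linarith
    have h2 := Set.ncard_lt_ncard hsub (Set.toFinite _)
    rw [hcard] at h2
    have : k ≤ Set.ncard {j : Fin m | t ≤ thetaTil m k X ihat (X (ihat l)) r j} := ht
    omega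

theorem gapk_thetaTil (m k : ℕ) (hk : 0 < k) (X : Fin m → ℝ)
    (ihat : Fin k → Fin m) (hinj : Function.Injective ihat)
    (hdec : ∀ a b : Fin k, a < b → X (ihat b) < X (ihat a)) (l : Fin k)
    (hl : ∀ a, a ≤ l) (r : ℝ) (hr : 0 ≤ r) (j : Fin m) :
    gapk m k (thetaTil m k X ihat (X (ihat l)) r) j / 2
      = max ((X (ihat l) - X j - r) / 3) 0 := by
  have hle : ∀ a, X (ihat l) ≤ X (ihat a) := by
    intro a
    rcases (hl a).lt_or_eq with h | h
    · exact (hdec _ _ h).le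
    · rw [h]
  unfold gapk
  rw [kth_thetaTil m k hk X ihat hinj hdec l hl r]
  unfold thetaTil
  split_ifs with h
  · obtain ⟨a, rfl⟩ := h
    have := hle a
    rw [max_eq_right, max_eq_right] <;> linarith
  · rcases le_total (2 / 3 * X j + 1 / 3 * (X (ihat l) - r)) (X (ihat l) - r) with h1 | h1
    · rw [min_eq_left h1, max_eq_left, max_eq_left] <;> linarith
    · rw [min_eq_right h1, max_eq_right, max_eq_right] <;> linarith

open Set Filter Topology in
theorem endpoint_core (m : ℕ) (α : ℝ) (hα0 : 0 < α) (hα1 : α < 1)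
    (S : ℝ → ℝ)
    (hScont : ContinuousOn S (Set.Ici (0 : ℝ)))
    (hSanti : StrictAntiOn S (Set.Ici (0 : ℝ)))
    (hS1 : S 0 = 1)
    (hSrange : ∀ r : ℝ, 0 ≤ r → 0 ≤ S r ∧ S r ≤ 1)
    (hSlim : Filter.Tendsto S Filter.atTop (nhds 0))
    (D : Fin m → ℝ) (l : Fin m) (hD : D l = 0) (A : Set ℝ)
    (hA : ∀ r, 0 ≤ r → (r ∈ A ↔
      r ≤ sInf {s : ℝ | 0 ≤ s ∧ ∑ j, S (max s (max ((D j - r) / 3) 0)) ≤ α})) :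
    α = ∑ j, S (max (sSup A) ((D j - sSup A) / 3)) := by
  set T : ℝ → ℝ := fun x => S (max x 0) with hT
  have hTc : Continuous T := by
    apply hScont.comp_continuous (by fun_prop)
    intro x; exact Set.mem_Ici.2 (le_max_right _ _)
  have hTS : ∀ x, 0 ≤ x → T x = S x := fun x hx => by simp [hT, max_eq_left hx]
  have hTanti : Antitone T := fun x y h => hSanti.antitoneOn
    (Set.mem_Ici.2 (le_max_right _ _)) (Set.mem_Ici.2 (le_max_right _ _))
    (max_le_max_right 0 h)
  have hTlim : Tendsto T atTop (𝓝 0) := by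
    apply hSlim.congr'
    filter_upwards [eventually_ge_atTop 0] with x hx using (hTS x hx).symm
  have hT0 : ∀ x, 0 ≤ T x := fun x => (hSrange _ (le_max_right _ _)).1
  have hSum : ∀ (c : Fin m → ℝ → ℝ), (∀ j x, x ≤ c j x) →
      Tendsto (fun x => ∑ j, T (c j x)) atTop (𝓝 0) := by
    intro c hc
    have : Tendsto (fun x => ∑ j, T (c j x)) atTop (𝓝 (∑ j : Fin m, (0:ℝ))) := by
      apply tendsto_finsetSum
      intro j _
      exact hTlim.comp (tendsto_atTop_mono (hc j) tendsto_id)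
    simpa using this
  set G : ℝ → ℝ := fun r => ∑ j, T (max r ((D j - r) / 3)) with hG
  have hGc : Continuous G := by rw [hG]; fun_prop
  have hGlim : Tendsto G atTop (𝓝 0) := hSum _ (fun j x => le_max_left _ _)
  have hGS : ∀ r, 0 ≤ r → G r = ∑ j, S (max r ((D j - r) / 3)) := fun r hr =>
    Finset.sum_congr rfl fun j _ => hTS _ (hr.trans (le_max_left _ _))
  have hG0 : α < G 0 := by
    have h1 : T (max 0 ((D l - 0) / 3)) ≤ G 0 :=
      Finset.single_le_sum (f := fun j => T (max 0 ((D j - 0) / 3)))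
        (fun j _ => hT0 _) (Finset.mem_univ l)
    have h2 : T (max 0 ((D l - 0) / 3)) = 1 := by simp [hD, hT, hS1]
    linarith
  have key : ∀ r, 0 ≤ r → (r ∈ A ↔ α ≤ G r) := by
    intro r hr
    rw [hA r hr]
    set F : ℝ → ℝ := fun s => ∑ j, T (max s (max ((D j - r) / 3) 0)) with hF
    have hFc : Continuous F := by rw [hF]; fun_prop
    have hFlim : Tendsto F atTop (𝓝 0) := hSum _ (fun j x => le_max_left _ _)
    have hFr : F r = G r := by
      apply Finset.sum_congr rfl
      intro j _
      congr 1
      rw [max_comm ((D j - r) / 3) 0, ← max_assoc, max_eq_left hr]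
    have hset : {s : ℝ | 0 ≤ s ∧ ∑ j, S (max s (max ((D j - r) / 3) 0)) ≤ α}
        = {s | 0 ≤ s ∧ F s ≤ α} := by
      ext s
      simp only [Set.mem_setOf_eq, hF]
      have : ∀ j, T (max s (max ((D j - r) / 3) 0)) = S (max s (max ((D j - r) / 3) 0)) :=
        fun j => hTS _ ((le_max_right _ _).trans (le_max_right _ _))
      simp only [this]
    rw [hset]
    have hbdd : BddBelow {s | 0 ≤ s ∧ F s ≤ α} := ⟨0, fun s hs => hs.1⟩
    constructor
    · intro h
      by_contra! hlt
      rcases hr.eq_or_lt with h0 | h0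
      · rw [← h0] at hlt; linarith
      · rw [← hFr] at hlt
        have hev : ∀ᶠ s in 𝓝[<] r, F s < α ∧ 0 < s :=
          nhdsWithin_le_nhds (((hFc.tendsto r).eventually_lt_const hlt).and (lt_mem_nhds h0))
        obtain ⟨s, ⟨hs1, hs2⟩, hs3⟩ := (hev.and self_mem_nhdsWithin).exists
        have := csInf_le hbdd (show s ∈ {s | 0 ≤ s ∧ F s ≤ α} from ⟨hs2.le, hs1.le⟩)
        have hs3' : s < r := hs3
        linarith
    · intro h
      apply le_csInf
      · obtain ⟨s, hs1, hs2⟩ :=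
          ((hFlim.eventually_lt_const hα0).and (eventually_ge_atTop 0)).exists
        exact ⟨s, hs2, hs1.le⟩
      · rintro s ⟨hs0, hs⟩
        by_contra! hlt
        have : F r < F s := by
          apply Finset.sum_lt_sum
          · intro j _
            exact hTanti (max_le_max_right _ hlt.le)
          · refine ⟨l, Finset.mem_univ l, ?_⟩
            have e : max ((D l - r) / 3) 0 = 0 := max_eq_right (by rw [hD]; linarith)
            rw [e, max_eq_left hr, max_eq_left hs0, hTS _ hr, hTS _ hs0]
            exact hSanti (Set.mem_Ici.2 hs0) (Set.mem_Ici.2 hr) hlt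
        linarith
  have hbA : BddAbove A := by
    obtain ⟨M, hM⟩ := eventually_atTop.1 (hGlim.eventually_lt_const hα0)
    refine ⟨max M 0, fun r hr => ?_⟩
    by_contra! hlt
    have h1 := (key r ((le_max_right _ _).trans hlt.le)).1 hr
    have h2 := hM r ((le_max_left _ _).trans hlt.le)
    linarith
  have h0A : (0:ℝ) ∈ A := (key 0 le_rfl).2 hG0.le
  have hs0 : 0 ≤ sSup A := le_csSup hbA h0A
  rw [← hGS _ hs0]
  apply le_antisymm
  · by_contra! hlt
    have hpos : 0 < sSup A := by
      rcases hs0.eq_or_lt with h | h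
      · rw [← h] at hlt; linarith
      · exact h
    have hev := (hGc.tendsto (sSup A)).eventually_lt_const hlt
    obtain ⟨ε, hε, hb⟩ := Metric.eventually_nhds_iff.1 hev
    obtain ⟨a, haA, ha⟩ := exists_lt_of_lt_csSup ⟨0, h0A⟩
      (show max (sSup A - ε) 0 < sSup A from max_lt (by linarith) hpos)
    have ha1 := (le_max_left _ _).trans_lt ha
    have ha2 := (le_max_right _ _).trans_lt ha
    have ha3 := le_csSup hbA haA
    have h1 := (key a ha2.le).1 haA
    have h2 := hb (show dist a (sSup A) < ε by rw [Real.dist_eq, abs_lt]; constructor <;> linarith)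
    linarith
  · by_contra! hlt
    have hev : ∀ᶠ s in 𝓝[>] (sSup A), α < G s :=
      nhdsWithin_le_nhds ((hGc.tendsto (sSup A)).eventually_const_lt hlt)
    obtain ⟨s, hs1, hs2⟩ := (hev.and self_mem_nhdsWithin).exists
    have hs2' : sSup A < s := hs2
    have := le_csSup hbA ((key s (hs0.trans hs2'.le)).2 hs1.le)
    linarith

/-- **Endpoint equation, top-k case.** Under the union bound `𝐒(v) = Σ_i S(v_i)`,
the radius `r_max = max{r : r ≤ r_α(θ̃^r)}` solves
`α = Σ_j S(max{r, (Δ̂^{(k)}_j − r)/3})`, where `Δ̂^{(k)}_j = X_{î_(k)} − X_j`. -/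
theorem topk_endpoint_equation
    (m k : ℕ) (hm : 0 < m) (hk : 0 < k) (hkm : k ≤ m)
    (α : ℝ) (hα0 : 0 < α) (hα1 : α < 1)
    (S : ℝ → ℝ)
    (hScont : ContinuousOn S (Set.Ici (0 : ℝ)))
    (hSanti : StrictAntiOn S (Set.Ici (0 : ℝ)))
    (hS1 : S 0 = 1)
    (hSrange : ∀ r : ℝ, 0 ≤ r → 0 ≤ S r ∧ S r ≤ 1)
    (hSlim : Filter.Tendsto S Filter.atTop (nhds 0))
    (X : Fin m → ℝ) (hXinj : Function.Injective X)
    (ihat : Fin k → Fin m) (hinj : Function.Injective ihat)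
    (hdec : ∀ a b : Fin k, a < b → X (ihat b) < X (ihat a))
    (hout : ∀ j, j ∉ Set.range ihat → ∀ a, X j < X (ihat a))
    (rmax : ℝ)
    (hrmax : rmax = rMax m k (fun v => ∑ i, S (v i)) α X ihat
      (X (ihat ⟨k - 1, Nat.sub_lt hk Nat.one_pos⟩))) :
    α = ∑ j, S (max rmax
      ((X (ihat ⟨k - 1, Nat.sub_lt hk Nat.one_pos⟩) - X j - rmax) / 3)) := by
  rw [hrmax]
  unfold rMax
  refine endpoint_core m α hα0 hα1 S hScont hSanti hS1 hSrange hSlim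
    (fun j => X (ihat ⟨k - 1, Nat.sub_lt hk Nat.one_pos⟩) - X j)
    (ihat ⟨k - 1, Nat.sub_lt hk Nat.one_pos⟩) (sub_self _) _ ?_
  intro r hr
  rw [Set.mem_setOf_eq]
  unfold rAk
  have hl : ∀ a : Fin k, a ≤ ⟨k - 1, Nat.sub_lt hk Nat.one_pos⟩ := by
    intro a
    rw [Fin.le_def]
    have := a.isLt
    simp only
    omega
  simp only [gapk_thetaTil m k hk X ihat hinj hdec _ hl r hr]
end
end

section
/- (Large observations must be active, variance-adaptive case.) Fix σ ∈ (0,∞)^m. Let X ∈ ℝ^m have a unique maximizer î = argmax_j X_j, let θ ∈ ℝ^m have a unique maximizer i* = argmax_j θ_j with value θ* = θ_{i*}, and suppose X ∈ A_α(θ). Then (i) î ∈ I_α(θ), and (ii) every index j with X_j ≥ θ* satisfies j ∈ I_α(θ). -/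
open Set

noncomputable section

/-- Variance-adaptive active radius
`r_α(θ) = min{r ≥ 0 : 𝐒((max{r σ_j, Δ_j(θ) σ_j/(σ_j + σ_{i*})})_j) ≤ α}`, with
`i*` the population winner of `θ` and `Δ_j(θ) = θ_{i*} − θ_j`. -/
def rAsig {m : ℕ} (S : (Fin m → ℝ) → ℝ) (α : ℝ) (σ : Fin m → ℝ)
    (θ : Fin m → ℝ) (istar : Fin m) : ℝ :=
  sInf {r : ℝ | 0 ≤ r ∧
    S (fun j => max (r * σ j) ((θ istar - θ j) * σ j / (σ j + σ istar))) ≤ α}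

/-- Variance-adaptive acceptance-region membership: `x ∈ A_α(θ)`, where
`A_α(θ)` has radius `max{r_α(θ) σ_j, Δ_j(θ) σ_j/(σ_j + σ_{i*})}` in coordinate `j`. -/
def acceptsig {m : ℕ} (S : (Fin m → ℝ) → ℝ) (α : ℝ) (σ : Fin m → ℝ)
    (θ : Fin m → ℝ) (istar : Fin m) (x : Fin m → ℝ) : Prop :=
  ∀ j, |x j - θ j| ≤
    max (rAsig S α σ θ istar * σ j) ((θ istar - θ j) * σ j / (σ j + σ istar))

/-- **Large observations must be active (variance-adaptive case).** If
`X ∈ A_α(θ)` with unique empirical winner `î` and unique population winner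
`i*`, then (i) `î` is active and (ii) every `j` with `X_j ≥ θ*` is active,
where active means `Δ_j(θ)/(σ_j + σ_{i*}) ≤ r_α(θ)`. -/
theorem large_observations_active_sigma
    (m : ℕ) (hm : 0 < m) (α : ℝ) (hα0 : 0 < α) (hα1 : α < 1)
    (σ : Fin m → ℝ) (hσ : ∀ j, 0 < σ j)
    (S : (Fin m → ℝ) → ℝ)
    (hS0 : ∀ v : Fin m → ℝ, (∀ j, 0 ≤ v j) → 0 ≤ S v)
    (hScont : ContinuousOn S {v : Fin m → ℝ | ∀ j, 0 ≤ v j})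
    (hSanti : ∀ v : Fin m → ℝ, (∀ j, 0 ≤ v j) → ∀ (j : Fin m) (a b : ℝ),
      0 ≤ a → a < b → S (Function.update v j b) < S (Function.update v j a))
    (hSlim : ∀ ε : ℝ, 0 < ε → ∃ M : ℝ, ∀ v : Fin m → ℝ, (∀ j, M ≤ v j) → S v < ε)
    (X θ : Fin m → ℝ)
    (ih : Fin m) (hih : ∀ j, j ≠ ih → X j < X ih)
    (istar : Fin m) (histar : ∀ j, j ≠ istar → θ j < θ istar)
    (hacc : acceptsig S α σ θ istar X) :
    (θ istar - θ ih) / (σ ih + σ istar) ≤ rAsig S α σ θ istar ∧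
    ∀ j, θ istar ≤ X j →
      (θ istar - θ j) / (σ j + σ istar) ≤ rAsig S α σ θ istar := by
  have hr : 0 ≤ rAsig S α σ θ istar := by
    unfold rAsig
    exact Real.sInf_nonneg (fun r hr => hr.1)
  unfold acceptsig at hacc
  generalize rAsig S α σ θ istar = r at hr hacc ⊢
  have key : ∀ j, r < (θ istar - θ j) / (σ j + σ istar) →
      0 < (θ istar - θ j) / (σ j + σ istar) ∧
      (θ istar - θ j) / (σ j + σ istar) * (σ j + σ istar) = θ istar - θ j ∧
      X j ≤ θ j + (θ istar - θ j) / (σ j + σ istar) * σ j := by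
    intro j hj
    have hs : 0 < σ j + σ istar := add_pos (hσ j) (hσ istar)
    refine ⟨lt_of_le_of_lt hr hj, div_mul_cancel₀ _ hs.ne', ?_⟩
    have h := hacc j
    rw [mul_div_right_comm, max_eq_right (mul_le_mul_of_nonneg_right hj.le (hσ j).le)] at h
    linarith [(abs_le.mp h).2]
  constructor
  · by_contra! hc
    obtain ⟨h1, h2, h3⟩ := key ih hc
    have hne : istar ≠ ih := by
      rintro rfl
      simp at h1
    have h4 := hih istar hne
    have h5 := hacc istar
    rw [sub_self, zero_mul, zero_div, max_eq_left (mul_nonneg hr (hσ istar).le)] at h5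
    have h6 := (abs_le.mp h5).1
    have h7 := mul_lt_mul_of_pos_right hc (hσ istar)
    linarith
  · intro j hj
    by_contra! hc
    obtain ⟨h1, h2, h3⟩ := key j hc
    have h7 := mul_pos h1 (hσ istar)
    linarith
end
end
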